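/- Any nondisturbing measurement by the first party is trivial on the 4p−4 states: if ⟨ψ_k, (B ⊗ I_n) ψ_l⟩ = 0 for all k, l with 1 ≤ k, l ≤ 4p−4 and k ≠ l, then ⟨ψ_k, (B ⊗ I_n) ψ_k⟩ = B_{00} for every k with 1 ≤ k ≤ 4p−4; in particular all 4p−4 outcome probabilities are equal. -/

import Mathlib

open scoped ComplexInnerProductSpace Kronecker ComplexOrder

/-- The `i`-th standard basis vector `|i⟩` of `ℂ^m` (zero if `i ≥ m`). -/
noncomputable def ket (m i : ℕ) : EuclideanSpace ℂ (Fin m) :=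
  (WithLp.equiv 2 (Fin m → ℂ)).symm fun a => if (a : ℕ) = i then 1 else 0

/-- The product state `v ⊗ w`, with entries `(v ⊗ w)_{(a,b)} = v_a * w_b`. -/
noncomputable def tp {m n : ℕ} (v : EuclideanSpace ℂ (Fin m)) (w : EuclideanSpace ℂ (Fin n)) :
    EuclideanSpace ℂ (Fin m × Fin n) :=
  (WithLp.equiv 2 (Fin m × Fin n → ℂ)).symm fun ab => v ab.1 * w ab.2

/-- The scalar `1/√2`. -/
noncomputable def invSqrt2 : ℂ := ((Real.sqrt 2)⁻¹ : ℝ)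

/-- A matrix on `ℂ^m ⊗ ℂ^n` acting as a linear map. -/
noncomputable def act {m n : ℕ} (M : Matrix (Fin m × Fin n) (Fin m × Fin n) ℂ)
    (x : EuclideanSpace ℂ (Fin m × Fin n)) : EuclideanSpace ℂ (Fin m × Fin n) :=
  Matrix.toEuclideanLin M x

/-- The index `j(i)`: `j(i) = i + 1` for `i ≤ p - 2`, and `j(p-1) = 1`. -/
def jf (p i : ℕ) : ℕ := if i = p - 1 then 1 else i + 1

/-- The `4p-4` product states `ψ_k` (`1 ≤ k ≤ 4p-4`):
`ψ_i = |i⟩ ⊗ (|0⟩-|i⟩)/√2`, `ψ_{i+p-1} = (|0⟩-|i⟩)/√2 ⊗ |j(i)⟩`,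
`ψ_{i+2p-2} = |i⟩ ⊗ (|0⟩+|i⟩)/√2`, `ψ_{i+3p-3} = (|0⟩+|i⟩)/√2 ⊗ |j(i)⟩`, for `1 ≤ i ≤ p-1`. -/
noncomputable def psi (m n p k : ℕ) : EuclideanSpace ℂ (Fin m × Fin n) :=
  if k ≤ p - 1 then tp (ket m k) (invSqrt2 • (ket n 0 - ket n k))
  else if k ≤ 2 * p - 2 then
    tp (invSqrt2 • (ket m 0 - ket m (k - (p - 1)))) (ket n (jf p (k - (p - 1))))
  else if k ≤ 3 * p - 3 then
    tp (ket m (k - (2 * p - 2))) (invSqrt2 • (ket n 0 + ket n (k - (2 * p - 2))))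
  else tp (invSqrt2 • (ket m 0 + ket m (k - (3 * p - 3)))) (ket n (jf p (k - (3 * p - 3))))

/-- The sesquilinear form of `B ⊗ 1` factors on product states. -/
lemma inner_tp_act_kronecker_one {m n : ℕ} (B : Matrix (Fin m) (Fin m) ℂ)
    (v v' : EuclideanSpace ℂ (Fin m)) (w w' : EuclideanSpace ℂ (Fin n)) :
    ⟪tp v w, act (B ⊗ₖ (1 : Matrix (Fin n) (Fin n) ℂ)) (tp v' w')⟫ =
      ⟪v, Matrix.toEuclideanLin B v'⟫ * ⟪w, w'⟫ := by
  have hact : act (B ⊗ₖ (1 : Matrix (Fin n) (Fin n) ℂ)) (tp v' w') =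
      tp (Matrix.toEuclideanLin B v') w' := by
    ext ⟨a, b⟩
    simp [act, tp, Matrix.toLpLin_apply, Matrix.mulVec, dotProduct, Matrix.one_apply,
      Fintype.sum_prod_type, Finset.sum_mul, mul_assoc]
  rw [hact]
  simp only [tp, PiLp.inner_apply, Fintype.sum_prod_type, Finset.sum_mul_sum]
  refine Finset.sum_congr rfl fun a _ => Finset.sum_congr rfl fun b _ => ?_
  simp
  ring

lemma ket_eq_single {m i : ℕ} (hi : i < m) :
    ket m i = EuclideanSpace.single (⟨i, hi⟩ : Fin m) (1 : ℂ) := by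
  ext a
  simp [ket, Fin.ext_iff]

lemma inner_ket_ket {n i j : ℕ} (hi : i < n) (hj : j < n) :
    ⟪ket n i, ket n j⟫ = if i = j then 1 else 0 := by
  simp [ket_eq_single hi, ket_eq_single hj, EuclideanSpace.inner_single_left]

lemma inner_ket_toEuclideanLin_ket {m i j : ℕ} (B : Matrix (Fin m) (Fin m) ℂ)
    (hi : i < m) (hj : j < m) :
    ⟪ket m i, Matrix.toEuclideanLin B (ket m j)⟫ = B ⟨i, hi⟩ ⟨j, hj⟩ := by
  simp [ket_eq_single hi, ket_eq_single hj, EuclideanSpace.inner_single_left,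
    Matrix.toLpLin_apply]

lemma invSqrt2_mul_self : invSqrt2 * invSqrt2 = 1 / 2 := by
  rw [invSqrt2, ← Complex.ofReal_mul, ← mul_inv, Real.mul_self_sqrt (by norm_num)]
  norm_num

lemma conj_invSqrt2 : (starRingEnd ℂ) invSqrt2 = invSqrt2 := Complex.conj_ofReal _

lemma invSqrt2_ne_zero : invSqrt2 ≠ 0 := by
  intro h
  simpa [h] using invSqrt2_mul_self

lemma psi_first (m n : ℕ) {p i : ℕ} (hip : i ≤ p - 1) :
    psi m n p i = tp (ket m i) (invSqrt2 • (ket n 0 - ket n i)) := by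
  rw [psi, if_pos hip]

lemma psi_second (m n : ℕ) {p i : ℕ} (hi : 1 ≤ i) (hip : i ≤ p - 1) :
    psi m n p (i + (p - 1)) = tp (invSqrt2 • (ket m 0 - ket m i)) (ket n (jf p i)) := by
  rw [psi, if_neg (by omega), if_pos (by omega), Nat.add_sub_cancel]

lemma psi_third (m n : ℕ) {p i : ℕ} (hi : 1 ≤ i) (hip : i ≤ p - 1) :
    psi m n p (i + (2 * p - 2)) = tp (ket m i) (invSqrt2 • (ket n 0 + ket n i)) := by
  rw [psi, if_neg (by omega), if_neg (by omega), if_pos (by omega), Nat.add_sub_cancel]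

lemma psi_fourth (m n : ℕ) {p i : ℕ} (hi : 1 ≤ i) (hip : i ≤ p - 1) :
    psi m n p (i + (3 * p - 3)) = tp (invSqrt2 • (ket m 0 + ket m i)) (ket n (jf p i)) := by
  rw [psi, if_neg (by omega), if_neg (by omega), if_neg (by omega), Nat.add_sub_cancel]

lemma exists_jf_eq {p i : ℕ} (h3 : 3 ≤ p) (hi : 1 ≤ i) (hip : i ≤ p - 1) :
    ∃ l, 1 ≤ l ∧ l ≤ p - 1 ∧ l ≠ i ∧ jf p l = i := by
  rcases eq_or_lt_of_le hi with rfl | hi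
  · exact ⟨p - 1, by omega, le_rfl, by omega, if_pos rfl⟩
  · refine ⟨i - 1, by omega, by omega, by omega, ?_⟩
    rw [jf, if_neg (by omega)]
    omega

lemma jf_lt {p i : ℕ} (h3 : 3 ≤ p) (hip : i ≤ p - 1) : jf p i < p := by
  unfold jf
  split <;> omega

theorem alice_measurement_trivial (p m n : ℕ) (h3 : 3 ≤ p) (hpm : p ≤ m) (hmn : m ≤ n)
    (B : Matrix (Fin m) (Fin m) ℂ) (hB : B.PosSemidef)
    (h : ∀ k l : ℕ, 1 ≤ k → k ≤ 4 * p - 4 → 1 ≤ l → l ≤ 4 * p - 4 → k ≠ l →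
      ⟪psi m n p k, act (B ⊗ₖ (1 : Matrix (Fin n) (Fin n) ℂ)) (psi m n p l)⟫ = 0) :
    ∀ k, 1 ≤ k → k ≤ 4 * p - 4 →
      ⟪psi m n p k, act (B ⊗ₖ (1 : Matrix (Fin n) (Fin n) ℂ)) (psi m n p k)⟫ =
        B (⟨0, by omega⟩ : Fin m) (⟨0, by omega⟩ : Fin m) := by
  have hm0 : 0 < m := by omega
  have hn0 : 0 < n := by omega
  have lt_m {i : ℕ} (hi : i ≤ p - 1) : i < m := by omega
  have lt_n {i : ℕ} (hi : i ≤ p - 1) : i < n := by omega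
  have j_lt {i : ℕ} (hi : i ≤ p - 1) : jf p i < n := by
    have := jf_lt h3 hi
    omega
  have off_diag {i l : ℕ} (hi : 1 ≤ i) (hip : i ≤ p - 1) (hl : 1 ≤ l) (hlp : l ≤ p - 1)
      (hil : i ≠ l) : B ⟨i, lt_m hip⟩ ⟨l, lt_m hlp⟩ = 0 := by
    have key := h i l hi (by omega) hl (by omega) hil
    rw [psi_first m n hip, psi_first m n hlp, inner_tp_act_kronecker_one] at key
    simpa [-inner_self_eq_norm_sq_to_K, inner_ket_ket, hn0, lt_n hip, lt_n hlp, hil,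
      show i ≠ 0 by omega, show 0 ≠ l by omega,
      inner_ket_toEuclideanLin_ket B (lt_m hip) (lt_m hlp), conj_invSqrt2, invSqrt2_ne_zero] using key
  have col_zero {i : ℕ} (hi : 1 ≤ i) (hip : i ≤ p - 1) :
      B ⟨i, lt_m hip⟩ ⟨0, hm0⟩ = 0 := by
    obtain ⟨l, hl, hlp, hli, hj⟩ := exists_jf_eq h3 hi hip
    have key := h (i + (2 * p - 2)) (l + (3 * p - 3)) (by omega) (by omega) (by omega) (by omega)
      (by omega)
    rw [psi_third m n hi hip, psi_fourth m n hl hlp, inner_tp_act_kronecker_one, hj] at key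
    simpa [-inner_self_eq_norm_sq_to_K, inner_ket_ket, hn0, lt_n hip, show 0 ≠ i by omega,
      inner_ket_toEuclideanLin_ket B (lt_m hip) (lt_m hlp),
      inner_ket_toEuclideanLin_ket B (lt_m hip) hm0,
      off_diag hi hip hl hlp hli.symm, conj_invSqrt2, invSqrt2_ne_zero] using key
  have row_zero_and_diag {i : ℕ} (hi : 1 ≤ i) (hip : i ≤ p - 1) :
      B ⟨0, hm0⟩ ⟨i, lt_m hip⟩ = 0 ∧ B ⟨i, lt_m hip⟩ ⟨i, lt_m hip⟩ = B ⟨0, hm0⟩ ⟨0, hm0⟩ := by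
    have key₁ := h (i + (p - 1)) (i + (3 * p - 3)) (by omega) (by omega) (by omega) (by omega)
      (by omega)
    have key₂ := h (i + (3 * p - 3)) (i + (p - 1)) (by omega) (by omega) (by omega) (by omega)
      (by omega)
    rw [psi_second m n hi hip, psi_fourth m n hi hip, inner_tp_act_kronecker_one] at key₁ key₂
    simp [-inner_self_eq_norm_sq_to_K, inner_ket_ket, j_lt hip,
      inner_ket_toEuclideanLin_ket B (lt_m hip) (lt_m hip),
      inner_ket_toEuclideanLin_ket B (lt_m hip) hm0, inner_ket_toEuclideanLin_ket B hm0 (lt_m hip),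
      inner_ket_toEuclideanLin_ket B hm0 hm0, col_zero hi hip, conj_invSqrt2,
      -mul_eq_zero] at key₁ key₂
    constructor
    · linear_combination key₁ - key₂ - 2 * B ⟨0, hm0⟩ ⟨i, lt_m hip⟩ * invSqrt2_mul_self
    · linear_combination -key₁ - key₂ -
        2 * (B ⟨i, lt_m hip⟩ ⟨i, lt_m hip⟩ - B ⟨0, hm0⟩ ⟨0, hm0⟩) * invSqrt2_mul_self
  intro k hk hkp
  have split_index :
      (∃ i, 1 ≤ i ∧ i ≤ p - 1 ∧ i = k) ∨
      (∃ i, 1 ≤ i ∧ i ≤ p - 1 ∧ k = i + (p - 1)) ∨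
      (∃ i, 1 ≤ i ∧ i ≤ p - 1 ∧ k = i + (2 * p - 2)) ∨
      (∃ i, 1 ≤ i ∧ i ≤ p - 1 ∧ k = i + (3 * p - 3)) := by
    by_cases h₁ : k ≤ p - 1
    · exact .inl ⟨k, by omega, by omega, by omega⟩
    by_cases h₂ : k ≤ 2 * p - 2
    · exact .inr (.inl ⟨k - (p - 1), by omega, by omega, by omega⟩)
    by_cases h₃ : k ≤ 3 * p - 3
    · exact .inr (.inr (.inl ⟨k - (2 * p - 2), by omega, by omega, by omega⟩))
    · exact .inr (.inr (.inr ⟨k - (3 * p - 3), by omega, by omega, by omega⟩))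
  rcases split_index with ⟨i, hi, hip, rfl⟩ | ⟨i, hi, hip, rfl⟩ | ⟨i, hi, hip, rfl⟩ |
      ⟨i, hi, hip, rfl⟩ <;>
    obtain ⟨row_zero, diag⟩ := row_zero_and_diag hi hip <;>
    first
      | rw [psi_first m n hip]
      | rw [psi_second m n hi hip]
      | rw [psi_third m n hi hip]
      | rw [psi_fourth m n hi hip]
  all_goals
    rw [inner_tp_act_kronecker_one]
    simp [-inner_self_eq_norm_sq_to_K, inner_ket_ket, j_lt hip, hn0, lt_n hip, show i ≠ 0 by omega,
      show 0 ≠ i by omega, conj_invSqrt2,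
      inner_ket_toEuclideanLin_ket B (lt_m hip) (lt_m hip),
      inner_ket_toEuclideanLin_ket B (lt_m hip) hm0, inner_ket_toEuclideanLin_ket B hm0 (lt_m hip),
      inner_ket_toEuclideanLin_ket B hm0 hm0, col_zero hi hip, row_zero, diag]
    linear_combination 2 * B ⟨0, hm0⟩ ⟨0, hm0⟩ * invSqrt2_mul_self
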